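/- Let n ≥ 2 and let f ∈ ℂ[x₁,…,xₙ] be a non-constant polynomial with f(0) = 0 which is convenient and non-degenerate at 0. With the deformation setup (P, l, σ_y f, Ω) fixed, the set Ω is Zariski open in ℂ^l: there exist finitely many polynomials g₁,…,g_k ∈ ℂ[y₁,…,y_l] such that Ω = {y ∈ ℂ^l : gᵢ(y) ≠ 0 for some i ∈ {1,…,k}}. -/

import Mathlib

open MvPolynomial

noncomputable section

/-- The exponent vector of a monomial, regarded as a point of `ℝⁿ`. -/
def expR {n : ℕ} (α : Fin n →₀ ℕ) : Fin n → ℝ := fun i => (α i : ℝ)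

/-- The convex hull of the union, over `α ∈ s`, of the translates `α + ℝ₊ⁿ` of the
nonnegative orthant. -/
def newtonRegion {n : ℕ} (s : Set (Fin n →₀ ℕ)) : Set (Fin n → ℝ) :=
  convexHull ℝ {x | ∃ α ∈ s, ∃ r : Fin n → ℝ, (∀ i, 0 ≤ r i) ∧ x = expR α + r}

/-- The Newton polyhedron `Γ₊(f)` of `f` at the origin. -/
def NewtonPolyhedron {n : ℕ} (f : MvPolynomial (Fin n) ℂ) : Set (Fin n → ℝ) :=
  newtonRegion {α | α ∈ f.support}

/-- The union of all bounded (nonempty, exposed) faces of `A`. -/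
def boundedFacesUnion {n : ℕ} (A : Set (Fin n → ℝ)) : Set (Fin n → ℝ) :=
  {x | ∃ F : Set (Fin n → ℝ), F.Nonempty ∧ IsExposed ℝ A F ∧
    Bornology.IsBounded F ∧ x ∈ F}

/-- The Newton boundary `Γ_f` of `f`: the union of the bounded faces of `Γ₊(f)`. -/
def NewtonBoundary {n : ℕ} (f : MvPolynomial (Fin n) ℂ) : Set (Fin n → ℝ) :=
  boundedFacesUnion (NewtonPolyhedron f)

/-- `f` is convenient: `Γ₊(f)` meets the positive part of every coordinate axis. -/
def Convenient {n : ℕ} (f : MvPolynomial (Fin n) ℂ) : Prop :=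
  ∀ i : Fin n, ∃ t : ℝ, 0 < t ∧ Pi.single i t ∈ NewtonPolyhedron f

open Classical in
/-- The part `f_F` of `f` supported on a subset `F ⊆ ℝⁿ`. -/
def faceRestrict {n : ℕ} (f : MvPolynomial (Fin n) ℂ) (F : Set (Fin n → ℝ)) :
    MvPolynomial (Fin n) ℂ :=
  ∑ α ∈ f.support.filter (fun α => expR α ∈ F), monomial α (f.coeff α)

/-- The system `g = ∂g/∂x₁ = ⋯ = ∂g/∂xₙ = 0` has a solution in `(ℂ ∖ {0})ⁿ`. -/
def hasTorusSolution {n : ℕ} (g : MvPolynomial (Fin n) ℂ) : Prop :=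
  ∃ x : Fin n → ℂ, (∀ i, x i ≠ 0) ∧ eval x g = 0 ∧ ∀ i, eval x (pderiv i g) = 0

/-- `f` is non-degenerate at `0`: for every bounded face `F` of `Γ₊(f)` the system
`f_F = ∂f_F/∂x₁ = ⋯ = ∂f_F/∂xₙ = 0` has no solution in the torus. -/
def NondegAtZero {n : ℕ} (f : MvPolynomial (Fin n) ℂ) : Prop :=
  ∀ F : Set (Fin n → ℝ), F.Nonempty → IsExposed ℝ (NewtonPolyhedron f) F →
    Bornology.IsBounded F → ¬ hasTorusSolution (faceRestrict f F)

/-- `x` is a singular point of the hypersurface `{h = 0} ⊆ ℂⁿ`. -/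
def IsSingularPt {n : ℕ} (h : MvPolynomial (Fin n) ℂ) (x : Fin n → ℂ) : Prop :=
  eval x h = 0 ∧ ∀ i, eval x (pderiv i h) = 0

/-- The deformed polynomial `σ_y f = Σ_α (a_α + y_α) x^α`. -/
def perturb {n : ℕ} (f : MvPolynomial (Fin n) ℂ) (S : Finset (Fin n →₀ ℕ))
    (y : {α // α ∈ S} → ℂ) : MvPolynomial (Fin n) ℂ :=
  f + ∑ α ∈ S.attach, monomial α.1 (y α)

/-- The parameter set `Ω ⊆ ℂ^{P ∩ ℤⁿ}`. -/
def Omega {n : ℕ} (f : MvPolynomial (Fin n) ℂ) (S : Finset (Fin n →₀ ℕ)) :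
    Set ({α // α ∈ S} → ℂ) :=
  {y | NewtonBoundary (perturb f S y) = NewtonBoundary f ∧ NondegAtZero (perturb f S y)}


open scoped Classical in
attribute [local instance] MvPolynomial.gradedAlgebra in
/-- Main theorem of elimination theory, pointwise form: if a homogeneous system with polynomial
parameters has no nontrivial solution at `y₀`, then it has none off a hypersurface avoiding `y₀`. -/
theorem exists_eval_ne_zero_of_forall_solution_eq_zero {A τ : Type*} [Finite A]
    (G : Set (MvPolynomial A (MvPolynomial τ ℂ)))
    (hG : ∀ g ∈ G, ∃ d, g.IsHomogeneous d) (y₀ : τ → ℂ)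
    (h₀ : ∀ z : A → ℂ, (∀ g ∈ G, eval z (map (eval y₀) g) = 0) → z = 0) :
    ∃ p : MvPolynomial τ ℂ, eval y₀ p ≠ 0 ∧ ∀ y, eval y p ≠ 0 →
      ∀ z : A → ℂ, (∀ g ∈ G, eval z (map (eval y) g) = 0) → z = 0 := by
  have := Fintype.ofFinite A
  let I : Ideal (MvPolynomial A (MvPolynomial τ ℂ)) := Ideal.span G
  have hI : I.IsHomogeneous (homogeneousSubmodule A (MvPolynomial τ ℂ)) :=
    Ideal.homogeneous_span _ _ fun g hg => (hG g hg).imp fun d hd => hd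
  let φ : MvPolynomial τ ℂ →+* ℂ := eval y₀
  have hφ : Function.Surjective φ := fun c => ⟨C c, eval_C c⟩
  have hvars : idealOfVars A ℂ ≤ (I.map (map φ)).radical := by
    rw [← vanishingIdeal_zeroLocus_eq_radical (K := ℂ), idealOfVars, Ideal.span_le]
    rintro _ ⟨a, rfl⟩ z hz
    have : z = 0 := h₀ z fun g hg => by
      have := hz _ (Ideal.mem_map_of_mem (map φ) (Ideal.subset_span hg))
      rwa [aeval_eq_eval] at this
    simp [this]
  obtain ⟨D, hD⟩ := Ideal.exists_pow_le_of_le_radical_of_fg hvars (idealOfVars_fg A ℂ)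
  let M := {m : A →₀ ℕ // m ∈ Finset.finsuppAntidiag Finset.univ D}
  let _ : Fintype M := Finset.Subtype.fintype _
  have hMdeg : ∀ m : A →₀ ℕ, m ∈ Finset.finsuppAntidiag Finset.univ D ↔ m.degree = D := by
    intro m
    simp [Finset.mem_finsuppAntidiag, Finsupp.degree_eq_sum]
  have hlift : ∀ m : M, ∃ Q ∈ I, Q.IsHomogeneous D ∧ map φ Q = monomial m.1 1 := by
    intro m
    have hm : monomial m.1 (1 : ℂ) ∈ I.map (map φ) :=
      hD ((monomial_mem_pow_idealOfVars_iff _ _ one_ne_zero).2 ((hMdeg _).1 m.2).ge)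
    obtain ⟨Q, hQ, hQm⟩ := (Ideal.mem_map_iff_of_surjective _ (map_surjective _ hφ)).1 hm
    refine ⟨homogeneousComponent D Q, homogeneousComponent_mem_of_mem hI hQ D,
      homogeneousComponent_isHomogeneous D Q, ?_⟩
    ext d
    rw [coeff_map, coeff_homogeneousComponent]
    split_ifs with hd
    · rw [← hQm, coeff_map]
    · rw [map_zero, coeff_monomial, if_neg]
      rintro rfl
      exact hd ((hMdeg _).1 m.2)
  choose Q hQI hQh hQm using hlift
  let B : Matrix M M (MvPolynomial τ ℂ) := Matrix.of fun m m' => coeff m'.1 (Q m)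
  refine ⟨B.det, ?_, ?_⟩
  · have : (eval y₀).mapMatrix B = 1 := by
      ext m m'
      have := congrArg (coeff m'.1) (hQm m)
      rw [coeff_map, coeff_monomial] at this
      simp only [RingHom.mapMatrix_apply, Matrix.map_apply, B, Matrix.of_apply, Matrix.one_apply]
      exact this.trans (if_congr Subtype.ext_iff.symm rfl rfl)
    rw [RingHom.map_det, this, Matrix.det_one]
    exact one_ne_zero
  · intro y hy z hz
    rw [RingHom.map_det] at hy
    have hIz : ∀ q ∈ I, eval z (map (eval y) q) = 0 := by
      intro q hq
      have : I ≤ RingHom.ker ((eval z).comp (map (eval y))) :=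
        Ideal.span_le.2 fun g hg => hz g hg
      exact this hq
    have hmul : ((eval y).mapMatrix B).mulVec (fun m : M => eval z (monomial m.1 (1 : ℂ))) = 0 := by
      ext m
      have h := hIz _ (hQI m)
      have hsub : (map (eval y) (Q m)).support ⊆ Finset.finsuppAntidiag Finset.univ D := by
        intro d hd
        rw [hMdeg]
        by_contra hne
        exact (mem_support_iff.1 hd) (((hQh m).map _).coeff_eq_zero hne)
      rw [eval_eq, Finset.sum_subset hsub (fun d _ hd => by
        rw [notMem_support_iff.1 hd, zero_mul])] at h
      rw [← Finset.sum_coe_sort] at h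
      simp only [Matrix.mulVec, dotProduct, Pi.zero_apply]
      rw [← h]
      refine Finset.sum_congr rfl fun d _ => ?_
      simp [B, coeff_map, eval_monomial, Finsupp.prod]
    have hzero := Matrix.eq_zero_of_mulVec_eq_zero hy hmul
    ext a
    have ha := congrFun hzero ⟨Finsupp.single a D, (hMdeg _).2 (by simp)⟩
    simp only [eval_monomial, Finsupp.prod_single_index, pow_zero, one_mul, Pi.zero_apply] at ha
    exact eq_zero_of_pow_eq_zero ha

/-- A union of basic Zariski open sets is a union of finitely many of them. -/
theorem exists_finite_eval_ne_zero {τ : Type*} [Finite τ] (U : Set (τ → ℂ))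
    (hU : ∀ y₀ ∈ U, ∃ p : MvPolynomial τ ℂ, eval y₀ p ≠ 0 ∧ ∀ y, eval y p ≠ 0 → y ∈ U) :
    ∃ (k : ℕ) (g : Fin k → MvPolynomial τ ℂ), U = {y | ∃ i : Fin k, eval y (g i) ≠ 0} := by
  let T : Set (MvPolynomial τ ℂ) := {p | ∀ y, eval y p ≠ 0 → y ∈ U}
  obtain ⟨s, hs⟩ := (inferInstance : IsNoetherian _ _).noetherian (Ideal.span T)
  have hsT : ∀ p ∈ Ideal.span T, ∀ y, eval y p ≠ 0 → y ∈ U := by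
    intro p hp y hy
    by_contra hyU
    have : Ideal.span T ≤ RingHom.ker (eval y) := Ideal.span_le.2 fun q hq => by
      by_contra hne
      exact hyU (hq y hne)
    exact hy (this hp)
  refine ⟨s.card, fun i => (s.equivFin.symm i : MvPolynomial τ ℂ), Set.ext fun y => ⟨?_, ?_⟩⟩
  · intro hy
    obtain ⟨p, hp, hpU⟩ := hU y hy
    by_contra hne
    replace hne : ∀ i, eval y (s.equivFin.symm i : MvPolynomial τ ℂ) = 0 :=
      fun i => by_contra fun hi => hne ⟨i, hi⟩
    have : Ideal.span T ≤ RingHom.ker (eval y) := by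
      rw [← hs]
      refine Submodule.span_le.2 fun q hq => ?_
      have := hne (s.equivFin ⟨q, hq⟩)
      simpa using this
    exact hp (this (Ideal.subset_span hpU))
  · rintro ⟨i, hi⟩
    refine hsT _ ?_ y hi
    rw [← hs]
    exact Submodule.subset_span (s.equivFin.symm i).2

/-- A real linear relation between integer vectors can be replaced by an integer one with the same
positive coefficients. -/
theorem exists_int_relation {A : Type*} [Finite A] {n : ℕ} (r : A → ℝ) :
    ∃ q : A → ℤ, (∀ a, 0 < r a → 0 < q a) ∧ (∀ a, 0 ≤ r a → 0 ≤ q a) ∧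
      ∀ [Fintype A] (v : A → Fin n → ℤ), (∀ i, ∑ a, r a * v a i = 0) →
        ∀ i, ∑ a, q a * v a i = 0 := by
  let M := Submodule.span ℤ (Set.range r)
  have : Module.Finite ℤ M := Module.Finite.span_of_finite ℤ (Set.finite_range r)
  let b := Module.Free.chooseBasis ℤ M
  let m : A → M := fun a => ⟨r a, Submodule.subset_span ⟨a, rfl⟩⟩
  let φ : ℕ → M →ₗ[ℤ] ℤ := fun N => b.constr ℤ fun j => ⌊(N : ℝ) * (b j : ℝ)⌋
  have hφ : ∀ (N : ℕ) (x : M), (N : ℝ) * x - ∑ j, |(b.repr x j : ℝ)| ≤ φ N x := by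
    intro N x
    have hx : (x : ℝ) = ∑ j, (b.repr x j : ℝ) * (b j : ℝ) := by
      have := congrArg M.subtype (b.sum_repr x)
      rw [map_sum] at this
      simpa using this.symm
    have hφx : (φ N x : ℝ) = ∑ j, (b.repr x j : ℝ) * (⌊(N : ℝ) * (b j : ℝ)⌋ : ℝ) := by
      simp [φ, Module.Basis.constr_apply_fintype]
    rw [hφx, hx, Finset.mul_sum, ← Finset.sum_sub_distrib]
    refine Finset.sum_le_sum fun j _ => ?_
    have h1 := Int.floor_le ((N : ℝ) * (b j : ℝ))
    have h2 := Int.lt_floor_add_one ((N : ℝ) * (b j : ℝ))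
    rcases abs_cases (b.repr x j : ℝ) with ⟨h, h'⟩ | ⟨h, h'⟩ <;> rw [h] <;> nlinarith
  have hev : ∀ᶠ N : ℕ in Filter.atTop, ∀ a, 0 < r a → 0 < φ N (m a) := by
    rw [Filter.eventually_all]
    intro a
    by_cases ha : 0 < r a
    · filter_upwards [(tendsto_natCast_atTop_atTop.atTop_mul_const ha).eventually_gt_atTop
        (∑ j, |(b.repr (m a) j : ℝ)|)] with N hN _
      have := hφ N (m a)
      have : (0 : ℝ) < φ N (m a) := by
        have h3 : ((m a : M) : ℝ) = r a := rfl
        rw [h3] at this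
        linarith
      exact_mod_cast this
    · exact Filter.Eventually.of_forall fun _ h => absurd h ha
  obtain ⟨N, hN⟩ := hev.exists
  refine ⟨fun a => φ N (m a), hN, fun a ha => ?_, fun v hv i => ?_⟩
  · rcases ha.eq_or_lt with h | h
    · have : m a = 0 := Subtype.ext h.symm
      simp [this]
    · exact (hN a h).le
  · have : ∑ a, v a i • m a = 0 := by
      apply Subtype.ext
      rw [ZeroMemClass.coe_zero, ← hv i]
      simp [m, mul_comm]
    have := congrArg (φ N) this
    simpa [mul_comm] using this

theorem ite_eq_single {ι R : Type*} [DecidableEq ι] [Zero R] [One R] (i : ι) :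
    (fun j => if i = j then (1 : R) else 0) = Pi.single i 1 := by
  ext j
  simp [Pi.single_apply, eq_comm]

/-- Characters of a sublattice with values in `ℂˣ` extend to the whole lattice. -/
theorem exists_torus_point {A : Type*} [Fintype A] {n : ℕ} (v : A → Fin n → ℤ) (z : A → ℂˣ)
    (h : ∀ q : A → ℤ, (∀ i, ∑ a, q a * v a i = 0) → ∏ a, z a ^ q a = 1) :
    ∃ x : Fin n → ℂˣ, ∀ a, ∏ i, x i ^ v a i = z a := by
  classical
  let _ : DivisibleBy (Additive ℂˣ) ℤ := by
    have := divisibleByOfSMulRightSurj (Additive ℂˣ) ℕ fun {k} hk x => by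
      obtain ⟨c, hc⟩ := IsAlgClosed.exists_pow_nat_eq (x.toMul : ℂ) (Nat.pos_of_ne_zero hk)
      have hc0 : c ≠ 0 := by
        rintro rfl
        rw [zero_pow hk] at hc
        exact x.toMul.ne_zero hc.symm
      refine ⟨Additive.ofMul (Units.mk0 c hc0), ?_⟩
      apply Additive.toMul.injective
      ext
      simpa using hc
    exact AddGroup.divisibleByIntOfDivisibleByNat _
  let V : (A → ℤ) →ₗ[ℤ] (Fin n → ℤ) := Fintype.linearCombination ℤ v
  let Z : (A → ℤ) →ₗ[ℤ] Additive ℂˣ :=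
    Fintype.linearCombination ℤ fun a => Additive.ofMul (z a)
  have hker : LinearMap.ker V ≤ LinearMap.ker Z := by
    intro q hq
    have h1 : ∀ i, ∑ a, q a * v a i = 0 := fun i => by
      simpa [V, Fintype.linearCombination_apply] using congrFun hq i
    have h2 := congrArg Additive.ofMul (h q h1)
    rw [LinearMap.mem_ker]
    simpa [Z, Fintype.linearCombination_apply] using h2
  obtain ⟨g, hg⟩ := (Module.Baer.of_divisible (Additive ℂˣ)).extension_property
    ((LinearMap.ker V).liftQ V le_rfl)
    (LinearMap.ker_eq_bot.1 (Submodule.ker_liftQ_eq_bot _ _ _ le_rfl))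
    ((LinearMap.ker V).liftQ Z hker)
  have hgV : ∀ q, g (V q) = Z q := fun q => by
    simpa using LinearMap.congr_fun hg (Submodule.Quotient.mk q)
  refine ⟨fun i => (g (Pi.single i 1)).toMul, fun a => ?_⟩
  have h1 := hgV (Pi.single a 1)
  have hV : V (Pi.single a 1) = v a := by simp [V]
  have hZ : Z (Pi.single a 1) = Additive.ofMul (z a) := by simp [Z]
  rw [hV, hZ, LinearMap.pi_apply_eq_sum_univ g (v a)] at h1
  have h2 := congrArg Additive.toMul h1
  simpa [toMul_sum, toMul_zsmul, ite_eq_single] using h2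

/-- Gordan's alternative for finitely many vectors. -/
theorem exists_separating_or_relation {A : Type*} [Fintype A] {n : ℕ} (v : A → Fin n → ℝ)
    (p : A → Prop) :
    (∃ u : Fin n → ℝ, (∀ a, p a → ∑ i, u i * v a i = 0) ∧ ∀ a, ¬ p a → 0 < ∑ i, u i * v a i) ∨
    ∃ r : A → ℝ, (∀ a, ¬ p a → 0 ≤ r a) ∧ (∃ a, ¬ p a ∧ 0 < r a) ∧
      ∀ i, ∑ a, r a * v a i = 0 := by
  classical
  let L : (A → ℝ) →ₗ[ℝ] (Fin n → ℝ) := Fintype.linearCombination ℝ v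
  let K : Set (A → ℝ) := stdSimplex ℝ A ∩ {r | ∀ a, p a → r a = 0}
  let W : Submodule ℝ (A → ℝ) :=
    { carrier := {r | ∀ a, ¬ p a → r a = 0}
      add_mem' := fun hr hs a ha => by simp [hr a ha, hs a ha]
      zero_mem' := fun a _ => rfl
      smul_mem' := fun c r hr a ha => by simp [hr a ha] }
  have hKcompact : IsCompact K := (isCompact_stdSimplex ℝ A).inter_right <| by
    simp only [Set.ofPred_forall]
    exact isClosed_iInter fun a => isClosed_iInter fun _ =>
      isClosed_eq (continuous_apply a) continuous_const
  have hKconvex : Convex ℝ K := (convex_stdSimplex ℝ A).inter <| by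
    intro r hr s hs c d _ _ _ a ha
    simp [hr a ha, hs a ha]
  by_cases hdisj : Disjoint (L '' K) (W.map L : Set (Fin n → ℝ))
  · left
    obtain ⟨g, c, d, hgK, hcd, hgW⟩ := geometric_hahn_banach_compact_closed
      (hKconvex.linear_image L) (hKcompact.image L.continuous_of_finiteDimensional)
      (W.map L).convex (W.map L).closed_of_finiteDimensional hdisj
    have hd : d < 0 := by simpa using hgW 0 (W.map L).zero_mem
    have hW : ∀ x ∈ W.map L, g x = 0 := by
      intro x hx
      by_contra hne
      have := hgW (((d - 1) / g x) • x) ((W.map L).smul_mem _ hx)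
      rw [map_smul, smul_eq_mul, div_mul_cancel₀ _ hne] at this
      linarith
    have hg : ∀ x, ∑ i, -g (Pi.single i 1) * x i = - g x := by
      intro x
      conv_rhs => rw [← ContinuousLinearMap.coe_coe, LinearMap.pi_apply_eq_sum_univ _ x]
      rw [← Finset.sum_neg_distrib]
      refine Finset.sum_congr rfl fun i _ => ?_
      rw [ite_eq_single]
      simp [mul_comm]
    have hL : ∀ a, L (Pi.single a 1) = v a := fun a => by simp [L]
    refine ⟨fun i => - g (Pi.single i 1), fun a ha => ?_, fun a ha => ?_⟩
    · rw [hg, hW _ ⟨Pi.single a 1, fun b hb => Pi.single_eq_of_ne (by rintro rfl; exact hb ha) _,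
        hL a⟩, neg_zero]
    · rw [hg]
      have := hgK (v a) ⟨Pi.single a 1, ⟨single_mem_stdSimplex ℝ a,
        fun b hb => Pi.single_eq_of_ne (by rintro rfl; exact ha hb) _⟩, hL a⟩
      linarith
  · right
    obtain ⟨_, ⟨r, ⟨hr, hrp⟩, rfl⟩, s, hs, hsr⟩ := Set.not_disjoint_iff.1 hdisj
    refine ⟨r - s, fun a ha => ?_, ?_, fun i => ?_⟩
    · simpa [hs a ha] using hr.1 a
    · by_contra! hne
      have : ∀ a, r a = 0 := fun a => by
        by_cases ha : p a
        · exact hrp a ha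
        · have := hne a ha
          rw [Pi.sub_apply, hs a ha, sub_zero] at this
          exact le_antisymm this (hr.1 a)
      have h1 := hr.2
      simp [this] at h1
    · have : L (r - s) = 0 := by rw [map_sub, hsr, sub_self]
      simpa [L, Fintype.linearCombination_apply] using congrFun this i

open scoped Matrix Pointwise

section Newton

variable {n : ℕ}

theorem newtonRegion_eq_add (s : Set (Fin n →₀ ℕ)) :
    newtonRegion s = convexHull ℝ (expR '' s) + Set.Ici 0 := by
  have : {x | ∃ α ∈ s, ∃ r : Fin n → ℝ, (∀ i, 0 ≤ r i) ∧ x = expR α + r} =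
      expR '' s + Set.Ici 0 := by
    ext x
    simp only [Set.mem_ofPred_eq, Set.mem_add, Set.exists_mem_image, Set.mem_Ici, Pi.le_def,
      Pi.zero_apply, eq_comm]
  rw [newtonRegion, this, convexHull_add, (convex_Ici (0 : Fin n → ℝ)).convexHull_eq]

theorem expR_mem_newtonRegion {s : Set (Fin n →₀ ℕ)} {α : Fin n →₀ ℕ} (hα : α ∈ s) :
    expR α ∈ newtonRegion s :=
  subset_convexHull ℝ _ ⟨α, hα, 0, fun _ => le_rfl, (add_zero _).symm⟩

theorem add_mem_newtonRegion {s : Set (Fin n →₀ ℕ)} {x r : Fin n → ℝ}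
    (hx : x ∈ newtonRegion s) (hr : 0 ≤ r) : x + r ∈ newtonRegion s := by
  rw [newtonRegion_eq_add] at hx ⊢
  obtain ⟨a, ha, b, hb, rfl⟩ := hx
  exact ⟨a, ha, b + r, add_nonneg hb hr, (add_assoc _ _ _).symm⟩

theorem newtonRegion_subset {s t : Set (Fin n →₀ ℕ)}
    (h : ∀ α ∈ t, expR α ∈ newtonRegion s) : newtonRegion t ⊆ newtonRegion s := by
  refine convexHull_min ?_ (convex_convexHull ℝ _)
  rintro _ ⟨α, hα, r, hr, rfl⟩
  exact add_mem_newtonRegion (h α hα) hr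

theorem isClosed_newtonRegion {s : Set (Fin n →₀ ℕ)} (hs : s.Finite) :
    IsClosed (newtonRegion s) := by
  rw [newtonRegion_eq_add]
  exact isClosed_Ici.add_left_of_isCompact ((hs.image _).isCompact_convexHull ℝ)

theorem le_dotProduct_of_mem_newtonRegion {s : Set (Fin n →₀ ℕ)} {w : Fin n → ℝ} (hw : 0 ≤ w)
    {c : ℝ} (hc : ∀ α ∈ s, c ≤ w ⬝ᵥ expR α) {x : Fin n → ℝ} (hx : x ∈ newtonRegion s) :
    c ≤ w ⬝ᵥ x := by
  have hconv : Convex ℝ {x : Fin n → ℝ | c ≤ w ⬝ᵥ x} := by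
    intro x hx y hy a b ha hb hab
    simp only [Set.mem_ofPred_eq, dotProduct_add, dotProduct_smul, smul_eq_mul] at hx hy ⊢
    have : c = a * c + b * c := by rw [← add_mul, hab, one_mul]
    rw [this]
    gcongr
  refine convexHull_min ?_ hconv hx
  rintro _ ⟨α, hα, r, hr, rfl⟩
  have : 0 ≤ w ⬝ᵥ r := dotProduct_nonneg_of_nonneg hw hr
  simp only [Set.mem_ofPred_eq, dotProduct_add]
  linarith [hc α hα]

theorem nonneg_of_mem_newtonRegion {s : Set (Fin n →₀ ℕ)} {x : Fin n → ℝ}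
    (hx : x ∈ newtonRegion s) (i : Fin n) : 0 ≤ x i := by
  have := le_dotProduct_of_mem_newtonRegion (w := Pi.single i 1) (c := 0)
    (Pi.single_nonneg.2 zero_le_one) (fun α _ => by simp [expR]) hx
  simpa using this

/-- The points of the Newton region of `s` at which the weight `w` is minimal. -/
def minRegion (w : Fin n → ℝ) (s : Set (Fin n →₀ ℕ)) : Set (Fin n → ℝ) :=
  {x | x ∈ newtonRegion s ∧ ∀ y ∈ newtonRegion s, w ⬝ᵥ x ≤ w ⬝ᵥ y}

theorem dotProduct_apply_single (l : StrongDual ℝ (Fin n → ℝ)) (x : Fin n → ℝ) :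
    (fun i => l (Pi.single i 1)) ⬝ᵥ x = l x := by
  conv_rhs => rw [← ContinuousLinearMap.coe_coe, LinearMap.pi_apply_eq_sum_univ _ x]
  refine Finset.sum_congr rfl fun i _ => ?_
  rw [ite_eq_single]
  simp [mul_comm]

theorem exists_minRegion_of_isExposed {s : Set (Fin n →₀ ℕ)} {F : Set (Fin n → ℝ)}
    (hF : F.Nonempty) (hexp : IsExposed ℝ (newtonRegion s) F) (hb : Bornology.IsBounded F) :
    ∃ w : Fin n → ℝ, (∀ i, 0 < w i) ∧ F = minRegion w s := by
  obtain ⟨l, rfl⟩ := hexp hF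
  obtain ⟨x, hx, hxmax⟩ := hF
  have hsingle : ∀ i, ∀ t : ℝ, 0 ≤ t → x + Pi.single i t ∈ newtonRegion s := fun i t ht =>
    add_mem_newtonRegion hx (Pi.single_nonneg.2 ht)
  have hl : ∀ i, ∀ t : ℝ, l (Pi.single i t) = t * l (Pi.single i 1) := fun i t => by
    rw [← smul_eq_mul, ← map_smul, ← Pi.single_smul, smul_eq_mul, mul_one]
  refine ⟨fun i => -l (Pi.single i 1), fun i => ?_, ?_⟩
  · have h1 : l (Pi.single i 1) ≤ 0 := by
      have := hxmax _ (hsingle i 1 zero_le_one)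
      rw [map_add] at this
      linarith
    refine neg_pos.2 (h1.lt_of_ne fun h0 => ?_)
    obtain ⟨R, hR⟩ := hb.exists_norm_le
    have hmem := hR (x + Pi.single i (|R| + |x i| + 1)) ⟨hsingle i _ (by positivity), fun y hy => by
      rw [map_add, hl, h0, mul_zero, add_zero]
      exact hxmax y hy⟩
    have h2 := (norm_le_pi_norm (x + Pi.single i (|R| + |x i| + 1)) i).trans hmem
    rw [Pi.add_apply, Pi.single_eq_same, Real.norm_eq_abs] at h2
    have := le_abs_self (x i + (|R| + |x i| + 1))
    have := neg_abs_le (x i)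
    have := le_abs_self R
    linarith
  · ext y
    have : ∀ z, (fun i => -l (Pi.single i 1)) ⬝ᵥ z = - l z := fun z => by
      rw [← dotProduct_apply_single l z, ← neg_dotProduct]
      rfl
    simp only [minRegion, Set.mem_ofPred_eq, this, neg_le_neg_iff]

theorem isExposed_minRegion (w : Fin n → ℝ) (s : Set (Fin n →₀ ℕ)) :
    IsExposed ℝ (newtonRegion s) (minRegion w s) := by
  intro _
  refine ⟨LinearMap.toContinuousLinearMap (-(dotProductBilin ℝ ℝ w)), ?_⟩
  ext x
  simp [minRegion]

theorem isBounded_minRegion {w : Fin n → ℝ} (hw : ∀ i, 0 < w i) (s : Set (Fin n →₀ ℕ)) :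
    Bornology.IsBounded (minRegion w s) := by
  rcases (minRegion w s).eq_empty_or_nonempty with h | ⟨x, hx, -⟩
  · rw [h]
    exact Bornology.isBounded_empty
  refine (Metric.isBounded_Icc 0 (fun i => w ⬝ᵥ x / w i)).subset fun y hy => ⟨?_, fun i => ?_⟩
  · exact nonneg_of_mem_newtonRegion hy.1
  · rw [le_div_iff₀ (hw i), mul_comm]
    refine le_trans ?_ (hy.2 x hx)
    exact Finset.single_le_sum (f := fun j => w j * y j)
      (fun j _ => mul_nonneg (hw j).le (nonneg_of_mem_newtonRegion hy.1 j)) (Finset.mem_univ i)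

open scoped Classical in
/-- The exponents in `E` at which the weight `w` is minimal. -/
def minFace (w : Fin n → ℝ) (E : Finset (Fin n →₀ ℕ)) : Finset (Fin n →₀ ℕ) :=
  E.filter fun α => ∀ β ∈ E, w ⬝ᵥ expR α ≤ w ⬝ᵥ expR β

theorem mem_minFace {w : Fin n → ℝ} {E : Finset (Fin n →₀ ℕ)} {α : Fin n →₀ ℕ} :
    α ∈ minFace w E ↔ α ∈ E ∧ ∀ β ∈ E, w ⬝ᵥ expR α ≤ w ⬝ᵥ expR β := by
  classical
  simp [minFace]

theorem minFace_nonempty (w : Fin n → ℝ) {E : Finset (Fin n →₀ ℕ)} (hE : E.Nonempty) :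
    (minFace w E).Nonempty := by
  obtain ⟨α, hα, h⟩ := E.exists_min_image (fun α => w ⬝ᵥ expR α) hE
  exact ⟨α, mem_minFace.2 ⟨hα, h⟩⟩

theorem expR_mem_minRegion_iff {w : Fin n → ℝ} (hw : ∀ i, 0 < w i) {E : Finset (Fin n →₀ ℕ)}
    {α : Fin n →₀ ℕ} (hα : α ∈ E) :
    expR α ∈ minRegion w (E : Set (Fin n →₀ ℕ)) ↔ α ∈ minFace w E := by
  rw [mem_minFace]
  refine ⟨fun h => ⟨hα, fun β hβ => h.2 _ (expR_mem_newtonRegion hβ)⟩, fun h => ?_⟩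
  exact ⟨expR_mem_newtonRegion hα, fun y hy =>
    le_dotProduct_of_mem_newtonRegion (fun i => (hw i).le) h.2 hy⟩

/-- The sets of exponents in `E` lying on a bounded face of the Newton region of `E`. -/
def IsNewtonFace (E A : Finset (Fin n →₀ ℕ)) : Prop :=
  ∃ w : Fin n → ℝ, (∀ i, 0 < w i) ∧ A = minFace w E

theorem IsNewtonFace.nonempty {E A : Finset (Fin n →₀ ℕ)} (h : IsNewtonFace E A)
    (hE : E.Nonempty) : A.Nonempty := by
  obtain ⟨w, -, rfl⟩ := h
  exact minFace_nonempty w hE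

theorem IsNewtonFace.isNewtonFace_minFace {E A : Finset (Fin n →₀ ℕ)} (h : IsNewtonFace E A)
    (u : Fin n → ℝ) : IsNewtonFace E (minFace u A) := by
  obtain ⟨w, hw, rfl⟩ := h
  have hcont : ∀ x : Fin n → ℝ, Continuous fun ε : ℝ => (w + ε • u) ⬝ᵥ x := fun x => by
    simp only [add_dotProduct, smul_dotProduct, smul_eq_mul]
    fun_prop
  have h1 : ∀ᶠ ε : ℝ in nhds 0, ∀ i, 0 < (w + ε • u) i := by
    rw [Filter.eventually_all]
    intro i
    have : Continuous fun ε : ℝ => (w + ε • u) i := by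
      simp only [Pi.add_apply, Pi.smul_apply, smul_eq_mul]
      fun_prop
    exact this.continuousAt.eventually_const_lt (by simpa using hw i)
  have h2 : ∀ᶠ ε : ℝ in nhds 0, ∀ α ∈ minFace w E, ∀ β ∈ E, β ∉ minFace w E →
      (w + ε • u) ⬝ᵥ expR α < (w + ε • u) ⬝ᵥ expR β := by
    simp only [Filter.eventually_all_finset]
    intro α hα β hβ
    by_cases hβm : β ∈ minFace w E
    · simp [hβm]
    · have hlt : w ⬝ᵥ expR α < w ⬝ᵥ expR β := by
        by_contra! hle
        exact hβm (mem_minFace.2 ⟨hβ, fun γ hγ => hle.trans ((mem_minFace.1 hα).2 γ hγ)⟩)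
      filter_upwards [(hcont _).continuousAt.eventually_lt (hcont _).continuousAt
        (by simpa using hlt)] with ε hε _ using hε
  obtain ⟨ε, ⟨hε1, hε2⟩, hε⟩ :=
    (((h1.and h2).filter_mono nhdsWithin_le_nhds).and (self_mem_nhdsWithin (s := Set.Ioi 0))).exists
  refine ⟨w + ε • u, hε1, ?_⟩
  have hcmp : ∀ α ∈ minFace w E, ∀ β ∈ minFace w E,
      ((w + ε • u) ⬝ᵥ expR α ≤ (w + ε • u) ⬝ᵥ expR β ↔ u ⬝ᵥ expR α ≤ u ⬝ᵥ expR β) := by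
    intro α hα β hβ
    have : w ⬝ᵥ expR α = w ⬝ᵥ expR β :=
      ((mem_minFace.1 hα).2 β (mem_minFace.1 hβ).1).antisymm
        ((mem_minFace.1 hβ).2 α (mem_minFace.1 hα).1)
    simp only [add_dotProduct, smul_dotProduct, smul_eq_mul, this, add_le_add_iff_left]
    exact mul_le_mul_iff_right₀ hε
  ext α
  rw [mem_minFace (w := u), mem_minFace (w := w + ε • u)]
  constructor
  · rintro ⟨hα, hαu⟩
    refine ⟨(mem_minFace.1 hα).1, fun β hβ => ?_⟩
    by_cases hβm : β ∈ minFace w E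
    · exact (hcmp α hα β hβm).2 (hαu β hβm)
    · exact (hε2 α hα β hβ hβm).le
  · rintro ⟨hα, hαw⟩
    have hαm : α ∈ minFace w E := by
      by_contra hne
      obtain ⟨γ, hγ⟩ := minFace_nonempty w ⟨α, hα⟩
      exact ((hε2 γ hγ α hα hne).trans_le (hαw γ (mem_minFace.1 hγ).1)).false
    exact ⟨hαm, fun β hβ => (hcmp α hαm β hβ).1 (hαw β (mem_minFace.1 hβ).1)⟩

theorem IsNewtonFace.exists_vertex {E : Finset (Fin n →₀ ℕ)} (hE : E.Nonempty)
    {A : Finset (Fin n →₀ ℕ)} (h : IsNewtonFace E A) : ∃ v ∈ A, IsNewtonFace E {v} := by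
  induction A using Finset.strongInduction with
  | H A ih =>
    by_cases hA : ∃ v, A = {v}
    · obtain ⟨v, rfl⟩ := hA
      exact ⟨v, Finset.mem_singleton_self v, h⟩
    obtain ⟨α, hα, β, hβ, hne⟩ : ∃ α ∈ A, ∃ β ∈ A, α ≠ β := by
      obtain ⟨α, hα⟩ := h.nonempty hE
      by_contra! hsub
      exact hA ⟨α, Finset.eq_singleton_iff_unique_mem.2 ⟨hα, fun β hβ => (hsub α hα β hβ).symm⟩⟩
    obtain ⟨i, hi⟩ := DFunLike.ne_iff.1 hne
    have hsub : minFace (Pi.single i 1) A ⊂ A := by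
      refine (Finset.ssubset_iff_subset_ne).2 ⟨fun γ hγ => (mem_minFace.1 hγ).1, fun heq => hi ?_⟩
      have h1 := (mem_minFace.1 (heq.symm ▸ hα)).2 β hβ
      have h2 := (mem_minFace.1 (heq.symm ▸ hβ)).2 α hα
      simp only [single_dotProduct, one_mul, expR, Nat.cast_le] at h1 h2
      exact le_antisymm h1 h2
    obtain ⟨v, hv, hvE⟩ := ih _ hsub (h.isNewtonFace_minFace _)
    exact ⟨v, hsub.1 hv, hvE⟩

theorem newtonRegion_eq_of_vertices_mem {s E : Finset (Fin n →₀ ℕ)} (hE : E.Nonempty)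
    (hs : s ⊆ E) (hv : ∀ v, IsNewtonFace E {v} → v ∈ s) :
    newtonRegion (s : Set (Fin n →₀ ℕ)) = newtonRegion E := by
  refine (newtonRegion_subset fun α hα => expR_mem_newtonRegion (hs hα)).antisymm
    (newtonRegion_subset fun α hα => ?_)
  by_contra hαs
  obtain ⟨l, c, hαc, hc⟩ := geometric_hahn_banach_point_closed (convex_convexHull ℝ _)
    (isClosed_newtonRegion s.finite_toSet) hαs
  let w : Fin n → ℝ := fun i => l (Pi.single i 1)
  have hwl : ∀ x, w ⬝ᵥ x = l x := dotProduct_apply_single l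
  obtain ⟨v₀, -, hv₀⟩ := IsNewtonFace.exists_vertex (E := E) hE ⟨1, fun _ => one_pos, rfl⟩
  have hw : 0 ≤ w := by
    intro i
    by_contra! hneg
    change w i < 0 at hneg
    have hle := hc _ (expR_mem_newtonRegion (hv v₀ hv₀))
    have hpos : 0 ≤ (l (expR v₀) - c) / -w i := div_nonneg (by linarith) (by linarith)
    have := hc _ (add_mem_newtonRegion (expR_mem_newtonRegion (hv v₀ hv₀))
      (Pi.single_nonneg.2 hpos : 0 ≤ Pi.single i _))
    rw [map_add, ← hwl (Pi.single i _), dotProduct_single, mul_div_assoc', mul_comm,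
      mul_div_assoc, div_neg, div_self hneg.ne] at this
    linarith
  have hev : ∀ᶠ ε : ℝ in nhds 0, w ⬝ᵥ expR α + ε * (1 ⬝ᵥ expR α) < c := by
    have hcont : Continuous fun ε : ℝ => w ⬝ᵥ expR α + ε * (1 ⬝ᵥ expR α) := by fun_prop
    exact hcont.continuousAt.eventually_lt_const (by simpa [hwl] using hαc)
  obtain ⟨ε, hεα, hε⟩ :=
    ((hev.filter_mono nhdsWithin_le_nhds).and (self_mem_nhdsWithin (s := Set.Ioi 0))).exists
  have hε : 0 < ε := hε
  obtain ⟨v, hvA, hvE⟩ := IsNewtonFace.exists_vertex (E := E) hE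
    ⟨w + ε • 1, fun i => add_pos_of_nonneg_of_pos (hw i) (by simpa using hε), rfl⟩
  have h1 := (mem_minFace.1 hvA).2 α hα
  have h2 := hc _ (expR_mem_newtonRegion (hv v hvE))
  have h3 : 0 ≤ ε * (1 ⬝ᵥ expR v) := mul_nonneg hε.le
    (dotProduct_nonneg_of_nonneg zero_le_one fun i => Nat.cast_nonneg _)
  simp only [add_dotProduct, smul_dotProduct, smul_eq_mul] at h1
  rw [← hwl] at h2
  linarith

end Newton

section Nondegeneracy

variable {n : ℕ}

theorem exists_dotProduct_le_of_mem_newtonRegion {s : Finset (Fin n →₀ ℕ)} {w : Fin n → ℝ}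
    (hw : 0 ≤ w) {x : Fin n → ℝ} (hx : x ∈ newtonRegion (s : Set (Fin n →₀ ℕ))) :
    ∃ α ∈ s, w ⬝ᵥ expR α ≤ w ⬝ᵥ x := by
  rcases s.eq_empty_or_nonempty with rfl | hs
  · simp [newtonRegion] at hx
  · obtain ⟨α, hα⟩ := minFace_nonempty w hs
    rw [mem_minFace] at hα
    exact ⟨α, hα.1, le_dotProduct_of_mem_newtonRegion hw hα.2 hx⟩

theorem hasTorusSolution_sum_monomial_iff (c : (Fin n →₀ ℕ) → ℂ) (A : Finset (Fin n →₀ ℕ)) :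
    hasTorusSolution (∑ α ∈ A, monomial α (c α)) ↔
      ∃ x : Fin n → ℂ, (∀ i, x i ≠ 0) ∧ ∑ α ∈ A, c α * ∏ i, x i ^ α i = 0 ∧
        ∀ i, ∑ α ∈ A, c α * α i * ∏ j, x j ^ α j = 0 := by
  refine exists_congr fun x => and_congr_right fun hx => and_congr ?_ (forall_congr' fun i => ?_)
  · simp [map_sum, eval_monomial, Finsupp.prod_fintype]
  · rw [← mul_eq_zero_iff_left (hx i)]
    have : x i * eval x (pderiv i (∑ α ∈ A, monomial α (c α))) =
        eval x (X i * pderiv i (∑ α ∈ A, monomial α (c α))) := by simp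
    rw [this, map_sum, Finset.mul_sum, map_sum]
    simp only [X_mul_pderiv_monomial]
    simp [eval_monomial, Finsupp.prod_fintype, mul_assoc, mul_left_comm]

theorem faceRestrict_minRegion {w : Fin n → ℝ} (hw : ∀ i, 0 < w i)
    (g : MvPolynomial (Fin n) ℂ) :
    faceRestrict g (minRegion w (g.support : Set (Fin n →₀ ℕ))) =
      ∑ α ∈ minFace w g.support, monomial α (g.coeff α) := by
  classical
  refine Finset.sum_congr ?_ fun _ _ => rfl
  ext α
  rw [Finset.mem_filter]
  exact ⟨fun h => (expR_mem_minRegion_iff hw h.1).1 h.2, fun h =>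
    ⟨(mem_minFace.1 h).1, (expR_mem_minRegion_iff hw (mem_minFace.1 h).1).2 h⟩⟩

theorem nondegAtZero_iff {g : MvPolynomial (Fin n) ℂ} (hg : g.support.Nonempty) :
    NondegAtZero g ↔ ∀ w : Fin n → ℝ, (∀ i, 0 < w i) →
      ¬ hasTorusSolution (∑ α ∈ minFace w g.support, monomial α (g.coeff α)) := by
  constructor
  · intro h w hw
    rw [← faceRestrict_minRegion hw]
    obtain ⟨α, hα⟩ := minFace_nonempty w hg
    exact h _ ⟨_, (expR_mem_minRegion_iff hw (mem_minFace.1 hα).1).2 hα⟩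
      (isExposed_minRegion w _) (isBounded_minRegion hw _)
  · intro h F hF hexp hb
    obtain ⟨w, hw, rfl⟩ := exists_minRegion_of_isExposed hF hexp hb
    have := h w hw
    rwa [← faceRestrict_minRegion hw] at this

theorem sum_minFace_support {g : MvPolynomial (Fin n) ℂ} {E : Finset (Fin n →₀ ℕ)}
    (hg : g.support ⊆ E) {w : Fin n → ℝ} {v : Fin n →₀ ℕ} (hv : v ∈ minFace w E)
    (hvg : v ∈ g.support) :
    ∑ α ∈ minFace w g.support, monomial α (g.coeff α) =
      ∑ α ∈ minFace w E, monomial α (g.coeff α) := by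
  rw [mem_minFace] at hv
  refine Finset.sum_subset (fun α hα => ?_) fun α hα hαg => ?_
  · rw [mem_minFace] at hα ⊢
    exact ⟨hg hα.1, fun β hβ => (hα.2 v hvg).trans (hv.2 β hβ)⟩
  · rw [mem_minFace] at hα
    rw [monomial_eq_zero]
    by_contra hne
    exact hαg (mem_minFace.2 ⟨mem_support_iff.2 hne, fun β hβ => hα.2 β (hg hβ)⟩)

theorem newtonBoundary_eq_and_nondegAtZero_iff {g : MvPolynomial (Fin n) ℂ}
    {E : Finset (Fin n →₀ ℕ)} (hE : E.Nonempty) (hg : g.support ⊆ E) :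
    NewtonBoundary g = boundedFacesUnion (newtonRegion (E : Set (Fin n →₀ ℕ))) ∧
        NondegAtZero g ↔
      ∀ A, IsNewtonFace E A → ¬ hasTorusSolution (∑ α ∈ A, monomial α (g.coeff α)) := by
  have hnondeg : (∀ v, IsNewtonFace E {v} → v ∈ g.support) →
      (NondegAtZero g ↔
        ∀ A, IsNewtonFace E A → ¬ hasTorusSolution (∑ α ∈ A, monomial α (g.coeff α))) := by
    intro hv
    have hmem : ∀ w : Fin n → ℝ, (∀ i, 0 < w i) → ∃ v ∈ minFace w E, v ∈ g.support := by
      intro w hw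
      obtain ⟨v, hvA, hvE⟩ := IsNewtonFace.exists_vertex hE ⟨w, hw, rfl⟩
      exact ⟨v, hvA, hv v hvE⟩
    obtain ⟨v₀, -, hv₀⟩ := hmem 1 fun _ => one_pos
    rw [nondegAtZero_iff ⟨v₀, hv₀⟩]
    constructor
    · rintro h _ ⟨w, hw, rfl⟩
      obtain ⟨v, hvA, hvg⟩ := hmem w hw
      rw [← sum_minFace_support hg hvA hvg]
      exact h w hw
    · intro h w hw
      obtain ⟨v, hvA, hvg⟩ := hmem w hw
      rw [sum_minFace_support hg hvA hvg]
      exact h _ ⟨w, hw, rfl⟩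
  constructor
  · rintro ⟨hΓ, hnd⟩
    refine (hnondeg ?_).1 hnd
    rintro v ⟨w, hw, hvw⟩
    have hvE : v ∈ minFace w E := hvw ▸ Finset.mem_singleton_self v
    have hvmem := (expR_mem_minRegion_iff hw (mem_minFace.1 hvE).1).2 hvE
    have hvΓ : expR v ∈ NewtonBoundary g := hΓ ▸
      ⟨_, ⟨_, hvmem⟩, isExposed_minRegion w _, isBounded_minRegion hw _, hvmem⟩
    obtain ⟨F, -, hF, -, hvF⟩ := hvΓ
    obtain ⟨α, hα, hle⟩ :=
      exists_dotProduct_le_of_mem_newtonRegion (fun i => (hw i).le) (hF.subset hvF)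
    have : α ∈ minFace w E :=
      mem_minFace.2 ⟨hg hα, fun β hβ => hle.trans ((mem_minFace.1 hvE).2 β hβ)⟩
    rw [← hvw, Finset.mem_singleton] at this
    exact this ▸ hα
  · intro h
    have hv : ∀ v, IsNewtonFace E {v} → v ∈ g.support := by
      intro v hv
      rw [mem_support_iff]
      intro h0
      refine h _ hv ⟨1, fun _ => one_ne_zero, ?_⟩
      simp [h0]
    refine ⟨?_, (hnondeg hv).2 h⟩
    rw [← newtonRegion_eq_of_vertices_mem hE hg hv]
    rfl

end Nondegeneracy

section Toric

variable {n : ℕ}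

/-- `z` lies on the affine cone over the projective toric variety of the exponents in `A`, and
solves the linear system expressing that `∑ α ∈ A, c α * x ^ α` is singular. -/
def IsToricSolution (c : (Fin n →₀ ℕ) → ℂ) (A : Finset (Fin n →₀ ℕ)) (z : A → ℂ) : Prop :=
  (∀ u v : A → ℕ, ∑ a, u a = ∑ a, v a → (∀ i, ∑ a, u a * a.1 i = ∑ a, v a * a.1 i) →
    ∏ a, z a ^ u a = ∏ a, z a ^ v a) ∧
  ∑ a, c a.1 * z a = 0 ∧ ∀ i, ∑ a, c a.1 * a.1 i * z a = 0

theorem exists_isToricSolution {c : (Fin n →₀ ℕ) → ℂ} {A : Finset (Fin n →₀ ℕ)}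
    (hA : A.Nonempty) (h : hasTorusSolution (∑ α ∈ A, monomial α (c α))) :
    ∃ z : A → ℂ, z ≠ 0 ∧ IsToricSolution c A z := by
  obtain ⟨x, hx, h0, hi⟩ := (hasTorusSolution_sum_monomial_iff c A).1 h
  refine ⟨fun a => ∏ i, x i ^ a.1 i, ?_, ?_, ?_, ?_⟩
  · obtain ⟨α, hα⟩ := hA
    exact fun h => Finset.prod_ne_zero_iff.2 (fun i _ => pow_ne_zero _ (hx i)) (congrFun h ⟨α, hα⟩)
  · intro u v _ huv
    have : ∀ u : A → ℕ, ∏ a, (∏ i, x i ^ a.1 i) ^ u a = ∏ i, x i ^ ∑ a, u a * a.1 i := by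
      intro u
      simp only [← Finset.prod_pow, ← pow_mul]
      rw [Finset.prod_comm]
      simp only [Finset.prod_pow_eq_pow_sum, mul_comm]
    simp only [this, huv]
  · rw [← h0, ← Finset.sum_coe_sort A]
  · intro i
    rw [← hi i, ← Finset.sum_coe_sort A]

theorem sum_eq_zero_of_relation {E A : Finset (Fin n →₀ ℕ)} (hE : (0 : Fin n →₀ ℕ) ∉ E)
    (hA : IsNewtonFace E A) {q : A → ℤ} (hq : ∀ i, ∑ a, q a * (a.1 i : ℤ) = 0) :
    ∑ a, q a = 0 := by
  obtain ⟨w, hw, rfl⟩ := hA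
  rcases (minFace w E).eq_empty_or_nonempty with hem | ⟨α, hα⟩
  · have : IsEmpty (minFace w E) := by
      rw [hem]
      infer_instance
    simp
  have hconst : ∀ a : minFace w E, w ⬝ᵥ expR a.1 = w ⬝ᵥ expR α := fun a =>
    ((mem_minFace.1 a.2).2 α (mem_minFace.1 hα).1).antisymm
      ((mem_minFace.1 hα).2 a.1 (mem_minFace.1 a.2).1)
  have hpos : 0 < w ⬝ᵥ expR α := by
    have hα0 : α ≠ 0 := fun h => hE (h ▸ (mem_minFace.1 hα).1)
    obtain ⟨i, hi⟩ := DFunLike.ne_iff.1 hα0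
    refine Finset.sum_pos' (fun j _ => mul_nonneg (hw j).le (Nat.cast_nonneg _))
      ⟨i, Finset.mem_univ i, mul_pos (hw i) ?_⟩
    exact Nat.cast_pos.2 (Nat.pos_of_ne_zero hi)
  have hzero : ∑ a : minFace w E, (q a : ℝ) * (w ⬝ᵥ expR a.1) = 0 := by
    simp only [dotProduct, Finset.mul_sum]
    rw [Finset.sum_comm]
    refine Finset.sum_eq_zero fun i _ => ?_
    have := congrArg (fun k : ℤ => w i * (k : ℝ)) (hq i)
    simp only [Int.cast_sum, Int.cast_mul, Int.cast_natCast, Finset.mul_sum, Int.cast_zero,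
      mul_zero] at this
    rw [← this]
    refine Finset.sum_congr rfl fun a _ => ?_
    simp only [expR]
    ring
  simp only [hconst, ← Finset.sum_mul] at hzero
  have := (mul_eq_zero.1 hzero).resolve_right hpos.ne'
  exact_mod_cast this

theorem IsToricSolution.prod_toNat_eq {c : (Fin n →₀ ℕ) → ℂ} {E A : Finset (Fin n →₀ ℕ)}
    (hE : (0 : Fin n →₀ ℕ) ∉ E) (hA : IsNewtonFace E A) {z : A → ℂ}
    (hz : IsToricSolution c A z) {q : A → ℤ} (hq : ∀ i, ∑ a, q a * (a.1 i : ℤ) = 0) :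
    ∏ a, z a ^ (q a).toNat = ∏ a, z a ^ (-q a).toNat := by
  refine hz.1 _ _ ?_ fun i => ?_
  · zify
    rw [← sub_eq_zero, ← Finset.sum_sub_distrib, ← sum_eq_zero_of_relation hE hA hq]
    exact Finset.sum_congr rfl fun a _ => Int.toNat_sub_toNat_neg _
  · zify
    rw [← sub_eq_zero, ← Finset.sum_sub_distrib, ← hq i]
    refine Finset.sum_congr rfl fun a _ => ?_
    rw [← sub_mul, Int.toNat_sub_toNat_neg]

theorem IsToricSolution.exists_isNewtonFace {c : (Fin n →₀ ℕ) → ℂ} {E A : Finset (Fin n →₀ ℕ)}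
    (hE : (0 : Fin n →₀ ℕ) ∉ E) (hA : IsNewtonFace E A) {z : A → ℂ}
    (hz : IsToricSolution c A z) (hz0 : z ≠ 0) :
    ∃ A' ⊆ A, IsNewtonFace E A' ∧ ∀ a : A, a.1 ∈ A' ↔ z a ≠ 0 := by
  rcases exists_separating_or_relation (fun a : A => expR a.1) (fun a => z a ≠ 0) with
    ⟨u, hu0, hupos⟩ | ⟨r, hr0, ⟨a₀, ha₀, hra₀⟩, hr⟩
  · obtain ⟨a₁, ha₁⟩ := Function.ne_iff.1 hz0
    refine ⟨minFace u A, fun α hα => (mem_minFace.1 hα).1, hA.isNewtonFace_minFace u, fun a => ?_⟩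
    rw [mem_minFace]
    constructor
    · intro h hza
      have h1 := h.2 a₁.1 a₁.2
      have h2 := hupos a (not_not.2 hza)
      have h3 := hu0 a₁ ha₁
      simp only [dotProduct] at h1
      linarith
    · refine fun h => ⟨a.2, fun β hβ => ?_⟩
      have h1 := hu0 a h
      simp only [dotProduct, h1]
      by_cases hb : z ⟨β, hβ⟩ = 0
      · exact (hupos ⟨β, hβ⟩ (not_not.2 hb)).le
      · exact (hu0 ⟨β, hβ⟩ hb).ge
  · exfalso
    obtain ⟨q, hqpos, hqnonneg, hq⟩ := exists_int_relation (n := n) r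
    have hrel := hq (fun a i => (a.1 i : ℤ)) fun i => by simpa [expR] using hr i
    have hprod := hz.prod_toNat_eq hE hA hrel
    rw [Finset.prod_eq_zero (Finset.mem_univ a₀)] at hprod
    · refine Finset.prod_ne_zero_iff.2 (fun a _ => ?_) hprod.symm
      by_cases ha : z a = 0
      · have := hqnonneg a (hr0 a (not_not.2 ha))
        rw [Int.toNat_of_nonpos (by omega), pow_zero]
        exact one_ne_zero
      · exact pow_ne_zero _ ha
    · rw [not_not.1 ha₀, zero_pow]
      have := hqpos a₀ hra₀
      omega

theorem IsToricSolution.exists_torus {c : (Fin n →₀ ℕ) → ℂ} {E A : Finset (Fin n →₀ ℕ)}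
    (hE : (0 : Fin n →₀ ℕ) ∉ E) (hA : IsNewtonFace E A) {z : A → ℂ}
    (hz : IsToricSolution c A z) :
    ∃ x : Fin n → ℂ, (∀ i, x i ≠ 0) ∧ ∀ a, z a ≠ 0 → ∏ i, x i ^ a.1 i = z a := by
  classical
  let v : A → Fin n → ℤ := fun a i => if z a = 0 then 0 else (a.1 i : ℤ)
  let t : A → ℂˣ := fun a => if h : z a = 0 then 1 else Units.mk0 (z a) h
  obtain ⟨x, hx⟩ := exists_torus_point v t fun q hq => by
    let q' : A → ℤ := fun a => if z a = 0 then 0 else q a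
    have hq' : ∀ i, ∑ a, q' a * (a.1 i : ℤ) = 0 := fun i => by
      rw [← hq i]
      refine Finset.sum_congr rfl fun a _ => ?_
      by_cases ha : z a = 0 <;> simp [q', v, ha]
    have hprod := hz.prod_toNat_eq hE hA hq'
    have hne : ∏ a, z a ^ (-q' a).toNat ≠ 0 := Finset.prod_ne_zero_iff.2 fun a _ => by
      by_cases ha : z a = 0
      · simp [q', ha]
      · exact pow_ne_zero _ ha
    ext
    rw [Units.coe_prod, Units.val_one, ← div_self hne]
    nth_rw 1 [← hprod]
    rw [← Finset.prod_div_distrib]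
    refine Finset.prod_congr rfl fun a _ => ?_
    by_cases ha : z a = 0
    · simp [t, q', ha]
    · simp only [t, q', ha, dite_false, if_false, Units.val_zpow_eq_zpow_val, Units.val_mk0]
      rw [← zpow_natCast, ← zpow_natCast, ← zpow_sub₀ ha, Int.toNat_sub_toNat_neg]
  refine ⟨fun i => x i, fun i => (x i).ne_zero, fun a ha => ?_⟩
  have := congrArg Units.val (hx a)
  simpa [v, t, ha] using this

theorem IsToricSolution.exists_hasTorusSolution {c : (Fin n →₀ ℕ) → ℂ}
    {E A : Finset (Fin n →₀ ℕ)} (hE : (0 : Fin n →₀ ℕ) ∉ E) (hA : IsNewtonFace E A) {z : A → ℂ}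
    (hz : IsToricSolution c A z) (hz0 : z ≠ 0) :
    ∃ A', IsNewtonFace E A' ∧ hasTorusSolution (∑ α ∈ A', monomial α (c α)) := by
  classical
  obtain ⟨A', hA'A, hA', hmem⟩ := hz.exists_isNewtonFace hE hA hz0
  obtain ⟨x, hx, hxz⟩ := hz.exists_torus hE hA
  have hsum : ∀ d : (Fin n →₀ ℕ) → ℂ,
      ∑ α ∈ A', d α * ∏ i, x i ^ α i = ∑ a : A, d a.1 * z a := by
    intro d
    rw [Finset.sum_coe_sort_eq_attach, ← Finset.inter_eq_right.2 hA'A, ← Finset.sum_ite_mem,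
      ← Finset.sum_attach]
    refine Finset.sum_congr rfl fun a _ => ?_
    by_cases ha : z a = 0
    · rw [if_neg (fun h => (hmem a).1 h ha), ha, mul_zero]
    · rw [if_pos ((hmem a).2 ha), hxz a ha]
  refine ⟨A', hA', (hasTorusSolution_sum_monomial_iff c A').2 ⟨x, hx, ?_, fun i => ?_⟩⟩
  · rw [hsum, hz.2.1]
  · rw [hsum fun α => c α * α i, hz.2.2 i]

/-- The homogeneous equations, with coefficients depending polynomially on parameters, whose
solutions are the toric solutions. -/
def toricSystem {τ : Type*} (c : (Fin n →₀ ℕ) → MvPolynomial τ ℂ) (A : Finset (Fin n →₀ ℕ)) :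
    Set (MvPolynomial A (MvPolynomial τ ℂ)) :=
  {g | ∃ u v : A → ℕ, ∑ a, u a = ∑ a, v a ∧ (∀ i, ∑ a, u a * a.1 i = ∑ a, v a * a.1 i) ∧
    g = ∏ a, X a ^ u a - ∏ a, X a ^ v a} ∪
  {g | g = ∑ a, C (c a.1) * X a ∨ ∃ i, g = ∑ a, C (c a.1 * (a.1 i : MvPolynomial τ ℂ)) * X a}

theorem isHomogeneous_of_mem_toricSystem {τ : Type*} {c : (Fin n →₀ ℕ) → MvPolynomial τ ℂ}
    {A : Finset (Fin n →₀ ℕ)} {g : MvPolynomial A (MvPolynomial τ ℂ)}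
    (hg : g ∈ toricSystem c A) : ∃ d, g.IsHomogeneous d := by
  rcases hg with ⟨u, v, huv, -, rfl⟩ | rfl | ⟨i, rfl⟩
  · refine ⟨∑ a, u a, (IsHomogeneous.prod _ _ _ fun a _ => isHomogeneous_X_pow a _).sub ?_⟩
    rw [huv]
    exact IsHomogeneous.prod _ _ _ fun a _ => isHomogeneous_X_pow a _
  · exact ⟨1, IsHomogeneous.sum _ _ _ fun a _ => isHomogeneous_C_mul_X _ a⟩
  · exact ⟨1, IsHomogeneous.sum _ _ _ fun a _ => isHomogeneous_C_mul_X _ a⟩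

theorem forall_mem_toricSystem_iff {τ : Type*} (c : (Fin n →₀ ℕ) → MvPolynomial τ ℂ)
    (A : Finset (Fin n →₀ ℕ)) (y : τ → ℂ) (z : A → ℂ) :
    (∀ g ∈ toricSystem c A, eval z (map (eval y) g) = 0) ↔
      IsToricSolution (fun α => eval y (c α)) A z := by
  constructor
  · refine fun h => ⟨fun u v huv hi => ?_, ?_, fun i => ?_⟩
    · have := h _ (Or.inl ⟨u, v, huv, hi, rfl⟩)
      simpa [sub_eq_zero] using this
    · simpa using h _ (Or.inr (Or.inl rfl))
    · simpa using h _ (Or.inr (Or.inr ⟨i, rfl⟩))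
  · rintro ⟨h1, h2, h3⟩ g (⟨u, v, huv, hi, rfl⟩ | rfl | ⟨i, rfl⟩)
    · simpa [sub_eq_zero] using h1 u v huv hi
    · simpa using h2
    · simpa using h3 i

/-- Non-degeneracy on all faces is a Zariski open condition on the coefficients. -/
theorem exists_finite_nondegenerate {τ : Type*} [Finite τ] {E : Finset (Fin n →₀ ℕ)}
    (hne : E.Nonempty) (hE : (0 : Fin n →₀ ℕ) ∉ E) (c : (Fin n →₀ ℕ) → MvPolynomial τ ℂ) :
    ∃ (k : ℕ) (g : Fin k → MvPolynomial τ ℂ),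
      {y : τ → ℂ | ∀ A, IsNewtonFace E A →
        ¬ hasTorusSolution (∑ α ∈ A, monomial α (eval y (c α)))} =
      {y | ∃ i : Fin k, eval y (g i) ≠ 0} := by
  classical
  refine exists_finite_eval_ne_zero _ fun y₀ hy₀ => ?_
  have helim : ∀ A, IsNewtonFace E A → ∃ p : MvPolynomial τ ℂ, eval y₀ p ≠ 0 ∧
      ∀ y, eval y p ≠ 0 → ¬ hasTorusSolution (∑ α ∈ A, monomial α (eval y (c α))) := by
    intro A hA
    obtain ⟨p, hp, hpy⟩ := exists_eval_ne_zero_of_forall_solution_eq_zero (toricSystem c A)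
      (fun _ => isHomogeneous_of_mem_toricSystem) y₀ fun z hz => by
        by_contra hz0
        obtain ⟨A', hA', h⟩ :=
          ((forall_mem_toricSystem_iff c A y₀ z).1 hz).exists_hasTorusSolution hE hA hz0
        exact hy₀ A' hA' h
    refine ⟨p, hp, fun y hy hsol => ?_⟩
    obtain ⟨z, hz0, hz⟩ := exists_isToricSolution (hA.nonempty hne) hsol
    exact hz0 (hpy y hy z ((forall_mem_toricSystem_iff c A y z).2 hz))
  choose! p hp hpy using helim
  refine ⟨∏ A ∈ E.powerset.filter (IsNewtonFace E), p A, ?_, fun y hy A hA => ?_⟩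
  · rw [map_prod]
    exact Finset.prod_ne_zero_iff.2 fun A hA => hp A (Finset.mem_filter.1 hA).2
  · rw [map_prod] at hy
    refine hpy A hA y (Finset.prod_ne_zero_iff.1 hy A (Finset.mem_filter.2 ⟨?_, hA⟩))
    obtain ⟨w, -, rfl⟩ := hA
    exact Finset.mem_powerset.2 fun α hα => (mem_minFace.1 hα).1

end Toric

theorem coeff_perturb {n : ℕ} (f : MvPolynomial (Fin n) ℂ) (S : Finset (Fin n →₀ ℕ))
    (y : {α // α ∈ S} → ℂ) (α : Fin n →₀ ℕ) :
    (perturb f S y).coeff α = f.coeff α + if h : α ∈ S then y ⟨α, h⟩ else 0 := by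
  classical
  rw [perturb, coeff_add, coeff_sum]
  congr 1
  simp only [coeff_monomial]
  split_ifs with h
  · rw [Finset.sum_eq_single ⟨α, h⟩]
    · simp
    · intro b _ hb
      exact if_neg fun hbα => hb (Subtype.ext hbα)
    · simp
  · exact Finset.sum_eq_zero fun b _ => if_neg fun hbα : b.1 = α => h (hbα ▸ b.2)

/-- `Ω` is Zariski open in `ℂ^l = ℂ^{P ∩ ℤⁿ}`: it is the set of points where at
least one of finitely many polynomials does not vanish. -/
theorem stmt4 (n : ℕ) (hn : 2 ≤ n) (f : MvPolynomial (Fin n) ℂ)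
    (hfnc : ¬ ∃ c : ℂ, f = C c) (hf0 : eval (0 : Fin n → ℂ) f = 0)
    (hconv : Convenient f) (hnd : NondegAtZero f)
    (P : Set (Fin n → ℝ)) (hPpoly : ∃ T : Finset (Fin n → ℝ), P = convexHull ℝ ↑T)
    (hPsub : P ⊆ NewtonPolyhedron f)
    (S : Finset (Fin n →₀ ℕ)) (hS : ∀ α : Fin n →₀ ℕ, α ∈ S ↔ expR α ∈ P)
    (hPface : boundedFacesUnion (newtonRegion {α | α ∈ S}) = NewtonBoundary f) :
    ∃ (k : ℕ) (g : Fin k → MvPolynomial ({α // α ∈ S}) ℂ),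
      Omega f S = {y | ∃ i : Fin k, eval y (g i) ≠ 0} := by
  classical
  let E : Finset (Fin n →₀ ℕ) := f.support ∪ S
  have hf : f ≠ 0 := fun h => hfnc ⟨0, by rw [h, C_0]⟩
  have hne : E.Nonempty := (support_nonempty.2 hf).mono Finset.subset_union_left
  have hEf : ∀ α ∈ E, expR α ∈ NewtonPolyhedron f := fun α hα =>
    (Finset.mem_union.1 hα).elim (fun h => expR_mem_newtonRegion h) fun h => hPsub ((hS α).1 h)
  have hregion : newtonRegion (E : Set (Fin n →₀ ℕ)) = NewtonPolyhedron f :=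
    (newtonRegion_subset hEf).antisymm
      (newtonRegion_subset fun α hα => expR_mem_newtonRegion (Finset.mem_union_left _ hα))
  have hE0 : (0 : Fin n →₀ ℕ) ∉ E := by
    intro h0
    obtain ⟨β, hβ, hle⟩ := exists_dotProduct_le_of_mem_newtonRegion (s := f.support)
      (w := 1) zero_le_one (hEf 0 h0)
    have hβ0 : β = 0 := by
      have h1 : ∑ i, (β i : ℝ) ≤ 0 := by simpa [dotProduct, expR] using hle
      ext i
      have h2 := Finset.single_le_sum (f := fun i => (β i : ℝ))
        (fun j _ => Nat.cast_nonneg _) (Finset.mem_univ i)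
      have h3 : (β i : ℝ) ≤ 0 := h2.trans h1
      have h4 : β i ≤ 0 := by exact_mod_cast h3
      simpa using h4
    rw [hβ0, mem_support_iff] at hβ
    exact hβ (by simpa [← constantCoeff_eq] using hf0)
  let c : (Fin n →₀ ℕ) → MvPolynomial {α // α ∈ S} ℂ := fun α =>
    C (f.coeff α) + if h : α ∈ S then X ⟨α, h⟩ else 0
  have hc : ∀ y α, (perturb f S y).coeff α = eval y (c α) := by
    intro y α
    rw [coeff_perturb]
    by_cases h : α ∈ S <;> simp [c, h]
  obtain ⟨k, g, hg⟩ := exists_finite_nondegenerate hne hE0 c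
  refine ⟨k, g, hg ▸ Set.ext fun y => ?_⟩
  have hsupp : (perturb f S y).support ⊆ E := by
    intro α hα
    by_contra hαE
    have h1 : α ∉ f.support ∧ α ∉ S := by simpa [E, not_or] using hαE
    rw [mem_support_iff, coeff_perturb, dif_neg h1.2, notMem_support_iff.1 h1.1] at hα
    simp at hα
  have := newtonBoundary_eq_and_nondegAtZero_iff hne hsupp
  rw [hregion] at this
  simp only [hc] at this
  exact this
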